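/- arXiv:math/0405236 — 2 statements merged into one kernel-verified Lean document; each statement's English description precedes it below -/
import Mathlib

section
/- Let $e \ge 1$ and $0 \le p \le e$, and let $Q(x_0,x_1)$ be any binary quadratic form over $\mathbb{C}$ with nonzero discriminant. Then the $2p$-th transvectant $(Q^e, Q^e)_{2p}$ is a nonzero scalar multiple of $Q^{2e-2p}$; in particular it is not identically zero. -/
open MvPolynomial

/-- Cayley's Omega operator `∂x₀∂y₁ - ∂y₀∂x₁` on polynomials in the four
variables `x₀ = X 0, x₁ = X 1, y₀ = X 2, y₁ = X 3`. -/
noncomputable def Omega : Module.End ℂ (MvPolynomial (Fin 4) ℂ) :=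
  (MvPolynomial.pderiv (0 : Fin 4)).toLinearMap * (MvPolynomial.pderiv (3 : Fin 4)).toLinearMap -
    (MvPolynomial.pderiv (2 : Fin 4)).toLinearMap * (MvPolynomial.pderiv (1 : Fin 4)).toLinearMap

open scoped Nat

/-- The coefficient of `X ^ l` in `X ^ i * (1 + X) ^ m`. -/
noncomputable def shiftedChoose (m i l : ℕ) : ℤ :=
  (Polynomial.X ^ i * (1 + Polynomial.X) ^ m : Polynomial ℤ).coeff l

theorem shiftedChoose_eq (m i l : ℕ) :
    shiftedChoose m i l = if i ≤ l then (m.choose (l - i) : ℤ) else 0 := by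
  simp [shiftedChoose, Polynomial.coeff_X_pow_mul', Polynomial.coeff_one_add_X_pow]

/-- The Toeplitz matrix of the coefficients of `(1 + X) ^ (2 * m)` is a Gram matrix. -/
theorem shiftedChoose_two_mul (m p i k : ℕ) (hk : k ≤ p) :
    shiftedChoose (2 * m) (i + (p - k)) (m + p) =
      ∑ l ∈ Finset.range (m + p + 1), shiftedChoose m i l * shiftedChoose m k l := by
  have hmul : (Polynomial.X ^ (i + (p - k)) * (1 + Polynomial.X) ^ (2 * m) : Polynomial ℤ) =
      (Polynomial.X ^ i * (1 + Polynomial.X) ^ m) *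
        (Polynomial.X ^ (p - k) * (1 + Polynomial.X) ^ m) := by ring
  rw [shiftedChoose, hmul, Polynomial.coeff_mul,
    Finset.Nat.sum_antidiagonal_eq_sum_range_succ_mk]
  refine Finset.sum_congr rfl fun l hl => ?_
  have hl' : l ≤ m + p := Finset.mem_range_succ_iff.mp hl
  change shiftedChoose m i l * shiftedChoose m (p - k) (m + p - l) = _
  congr 1
  rw [shiftedChoose_eq, shiftedChoose_eq]
  split_ifs with h₁ h₂ h₂
  · rw [← Nat.choose_symm_of_eq_add (n := m) (by omega : m = (m + p - l - (p - k)) + (l - k))]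
  · rw [Nat.choose_eq_zero_of_lt (by omega), Nat.cast_zero]
  · rw [Nat.choose_eq_zero_of_lt (by omega), Nat.cast_zero]
  · rfl

theorem sum_neg_one_pow_mul_choose_two_mul (p : ℕ) (h : ℕ → ℤ) :
    ∑ j ∈ Finset.range (2 * p + 1), (-1) ^ j * ((2 * p).choose j : ℤ) * h j =
      ∑ i ∈ Finset.range (p + 1), ∑ k ∈ Finset.range (p + 1),
        ((-1) ^ i * (p.choose i : ℤ)) * ((-1) ^ k * (p.choose k : ℤ)) * h (i + k) := by
  let Λ : Polynomial ℤ →ₗ[ℤ] ℤ := (Polynomial.basisMonomials ℤ).constr ℤ h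
  have hΛ (j : ℕ) : Λ (Polynomial.X ^ j) = h j := by
    rw [← Polynomial.monomial_one_right_eq_X_pow]
    simpa only [Polynomial.coe_basisMonomials] using
      (Polynomial.basisMonomials ℤ).constr_basis ℤ h j
  have hexp (n : ℕ) : ((-Polynomial.X + 1) ^ n : Polynomial ℤ) =
      ∑ j ∈ Finset.range (n + 1), ((-1) ^ j * (n.choose j : ℤ)) • Polynomial.X ^ j := by
    rw [add_pow]
    refine Finset.sum_congr rfl fun j _ => ?_
    rw [neg_pow, zsmul_eq_mul]
    push_cast
    ring
  have hsq := congrArg Λ (two_mul p ▸ pow_add (-Polynomial.X + 1 : Polynomial ℤ) p p)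
  rw [hexp, hexp, Finset.sum_mul_sum] at hsq
  simp only [map_sum, smul_mul_smul_comm, ← pow_add, map_smul, hΛ, smul_eq_mul] at hsq
  simpa only [pow_add] using hsq

/-- Up to the sign `(-1) ^ p`, this alternating sum is a sum of squares. -/
theorem alternating_sum_choose_mul_sq_ne_zero (m p : ℕ) :
    ∑ j ∈ Finset.range (2 * p + 1),
      (-1) ^ j * ((2 * p).choose j : ℤ) * shiftedChoose (2 * m) j (m + p) ^ 2 ≠ 0 := by
  let f (l l' : ℕ) : ℤ := ∑ i ∈ Finset.range (p + 1),
    (-1) ^ i * (p.choose i : ℤ) * shiftedChoose m i l * shiftedChoose m i l'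
  have hsum : ∑ j ∈ Finset.range (2 * p + 1),
      (-1) ^ j * ((2 * p).choose j : ℤ) * shiftedChoose (2 * m) j (m + p) ^ 2 =
      (-1) ^ p * ∑ l ∈ Finset.range (m + p + 1), ∑ l' ∈ Finset.range (m + p + 1), f l l' ^ 2 := by
    have hleft : ∀ i, ∑ k ∈ Finset.range (p + 1),
        ((-1) ^ i * (p.choose i : ℤ)) * ((-1) ^ k * (p.choose k : ℤ)) *
          shiftedChoose (2 * m) (i + k) (m + p) ^ 2 =
        ∑ k ∈ Finset.range (p + 1), ∑ l ∈ Finset.range (m + p + 1),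
          ∑ l' ∈ Finset.range (m + p + 1), (-1) ^ p *
            (((-1) ^ i * (p.choose i : ℤ) * shiftedChoose m i l * shiftedChoose m i l') *
              ((-1) ^ k * (p.choose k : ℤ) * shiftedChoose m k l * shiftedChoose m k l')) := by
      intro i
      rw [← Finset.sum_range_reflect]
      refine Finset.sum_congr rfl fun k hk => ?_
      have hk' : k ≤ p := Finset.mem_range_succ_iff.mp hk
      have hsign : (-1 : ℤ) ^ (p - k) = (-1) ^ p * (-1) ^ k := by
        obtain ⟨d, rfl⟩ := Nat.exists_eq_add_of_le hk'
        rw [Nat.add_sub_cancel_left, pow_add, mul_right_comm, ← mul_pow]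
        simp
      rw [Nat.add_sub_cancel, hsign, Nat.choose_symm hk', shiftedChoose_two_mul m p i k hk', sq,
        Finset.sum_mul_sum, Finset.mul_sum]
      refine Finset.sum_congr rfl fun l _ => ?_
      rw [Finset.mul_sum]
      exact Finset.sum_congr rfl fun l' _ => by ring
    rw [sum_neg_one_pow_mul_choose_two_mul p fun j => shiftedChoose (2 * m) j (m + p) ^ 2,
      Finset.sum_congr rfl fun i _ => hleft i]
    simp only [f, sq, Finset.sum_mul_sum]
    simp only [Finset.mul_sum]
    rw [Finset.sum_congr rfl fun i _ => Finset.sum_comm, Finset.sum_comm]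
    refine Finset.sum_congr rfl fun l _ => ?_
    rw [Finset.sum_congr rfl fun i _ => Finset.sum_comm, Finset.sum_comm]
  have hcorner : f (m + p) p = (-1) ^ p := by
    simp only [f]
    rw [Finset.sum_eq_single_of_mem p (Finset.self_mem_range_succ p)]
    · simp [shiftedChoose_eq]
    · intro i hi hip
      have hi' : i ≤ p := Finset.mem_range_succ_iff.mp hi
      rw [shiftedChoose_eq m i (m + p), Nat.choose_eq_zero_of_lt (by omega : m < m + p - i)]
      simp
  have hpos : 0 < ∑ l ∈ Finset.range (m + p + 1), ∑ l' ∈ Finset.range (m + p + 1), f l l' ^ 2 := by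
    refine Finset.sum_pos' (fun l _ => Finset.sum_nonneg fun l' _ => sq_nonneg _)
      ⟨m + p, by simp, Finset.sum_pos' (fun l' _ => sq_nonneg _) ⟨p, by simp, ?_⟩⟩
    rw [hcorner]
    positivity
  rw [hsum]
  exact mul_ne_zero (by simp) hpos.ne'

theorem descFactorial_mul_descFactorial_mul_factorial (m p j : ℕ) (hj : j ≤ 2 * p) :
    (((m + p).descFactorial j * (m + p).descFactorial (2 * p - j) * (2 * m)! : ℕ) : ℤ) =
      ((m + p)! ^ 2 : ℕ) * shiftedChoose (2 * m) j (m + p) := by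
  rw [shiftedChoose_eq]
  split_ifs with h₁
  · norm_cast
    by_cases h₂ : 2 * p - j ≤ m + p
    · have hle : m + p - j ≤ 2 * m := by omega
      have h₃ := Nat.choose_mul_factorial_mul_factorial hle
      have h₄ := Nat.factorial_mul_descFactorial h₁
      have h₅ := Nat.factorial_mul_descFactorial h₂
      rw [show 2 * m - (m + p - j) = m + p - (2 * p - j) by omega] at h₃
      rw [← h₃, sq]
      calc _ = ((m + p - j)! * (m + p).descFactorial j) *
            ((m + p - (2 * p - j))! * (m + p).descFactorial (2 * p - j)) *
            (2 * m).choose (m + p - j) := by ring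
        _ = _ := by rw [h₄, h₅]
    · rw [Nat.descFactorial_of_lt (by omega : m + p < 2 * p - j),
        Nat.choose_eq_zero_of_lt (by omega : 2 * m < m + p - j)]
      simp
  · rw [Nat.descFactorial_of_lt (by omega)]
    simp

theorem alternating_sum_descFactorial_ne_zero (e p : ℕ) (hp : p ≤ e) :
    ∑ j ∈ Finset.range (2 * p + 1), (-1) ^ j * ((2 * p).choose j : ℤ) *
      (e.descFactorial j * e.descFactorial (2 * p - j) : ℤ) ^ 2 ≠ 0 := by
  obtain ⟨m, rfl⟩ : ∃ m, e = m + p := ⟨e - p, by omega⟩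
  intro h
  refine mul_ne_zero (pow_ne_zero 2 (Nat.cast_ne_zero.mpr (pow_ne_zero 2 (m + p).factorial_ne_zero)))
    (alternating_sum_choose_mul_sq_ne_zero m p) ?_
  rw [← zero_mul (((2 * m)! : ℤ) ^ 2), ← h, Finset.mul_sum, Finset.sum_mul]
  refine Finset.sum_congr rfl fun j hj => ?_
  have := descFactorial_mul_descFactorial_mul_factorial m p j (Finset.mem_range_succ_iff.mp hj)
  rw [mul_left_comm, ← mul_pow, ← this]
  push_cast
  ring

theorem pderiv_comp_pderiv_pow_apply (i j : Fin 4) (hij : i ≠ j) (k r s : ℕ)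
    (F : MvPolynomial (Fin 4) ℂ) (hi : pderiv i F = 0) (hj : pderiv j F = 0) :
    (((pderiv i).toLinearMap * (pderiv j).toLinearMap : Module.End ℂ (MvPolynomial (Fin 4) ℂ)) ^ k)
        (X i ^ r * X j ^ s * F) =
      C ((r.descFactorial k * s.descFactorial k : ℕ) : ℂ) *
        (X i ^ (r - k) * X j ^ (s - k) * F) := by
  induction k with
  | zero => simp
  | succ k ih =>
    rw [pow_succ', Module.End.mul_apply, ih]
    simp [hij, hij.symm, hi, hj, Derivation.leibniz, Derivation.leibniz_pow,
      Nat.descFactorial_succ, ← Nat.sub_sub, -Nat.cast_sub]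
    ring

theorem commute_pderiv (i j : Fin 4) :
    Commute ((pderiv i).toLinearMap : Module.End ℂ (MvPolynomial (Fin 4) ℂ))
      (pderiv j).toLinearMap :=
  LinearMap.ext fun F => by
    have hzero : ⁅(pderiv i : Derivation ℂ (MvPolynomial (Fin 4) ℂ) _), pderiv j⁆ = 0 :=
      MvPolynomial.derivation_ext fun k => by
        rw [Derivation.commutator_apply, pderiv_X, pderiv_X]
        by_cases hi : i = k <;> by_cases hj : j = k <;> simp [hi, hj]
    have hF := DFunLike.congr_fun hzero F
    rw [Derivation.commutator_apply, Derivation.zero_apply, sub_eq_zero] at hF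
    simpa only [Module.End.mul_apply, Derivation.coeFn_coe] using hF

theorem neg_one_pow_End_apply (j : ℕ) (F : MvPolynomial (Fin 4) ℂ) :
    ((-1 : Module.End ℂ (MvPolynomial (Fin 4) ℂ)) ^ j) F = C ((-1) ^ j) * F := by
  induction j with
  | zero => simp
  | succ j ih => rw [pow_succ', Module.End.mul_apply, ih]; simp [pow_succ]

theorem Omega_pow_apply (n e : ℕ) :
    (Omega ^ n) (X 0 ^ e * X 1 ^ e * (X 2 ^ e * X 3 ^ e)) =
      ∑ j ∈ Finset.range (n + 1), C ((-1) ^ j * (n.choose j : ℂ) *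
        (e.descFactorial j * e.descFactorial (n - j) : ℂ) ^ 2) *
        (X 0 ^ (e - (n - j)) * X 3 ^ (e - (n - j)) * (X 2 ^ (e - j) * X 1 ^ (e - j))) := by
  have hcomm : Commute
      (-((pderiv 2).toLinearMap * (pderiv 1).toLinearMap) :
        Module.End ℂ (MvPolynomial (Fin 4) ℂ))
      ((pderiv 0).toLinearMap * (pderiv 3).toLinearMap) :=
    (((commute_pderiv 2 0).mul_right (commute_pderiv 2 3)).mul_left
      ((commute_pderiv 1 0).mul_right (commute_pderiv 1 3))).neg_left
  rw [Omega, sub_eq_neg_add, hcomm.add_pow, LinearMap.sum_apply]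
  refine Finset.sum_congr rfl fun j _ => ?_
  rw [← Nat.cast_comm, Module.End.mul_apply, Module.End.natCast_apply, Module.End.mul_apply,
    show (X 0 ^ e * X 1 ^ e * (X 2 ^ e * X 3 ^ e) : MvPolynomial (Fin 4) ℂ) =
      X 0 ^ e * X 3 ^ e * (X 2 ^ e * X 1 ^ e) by ring,
    pderiv_comp_pderiv_pow_apply 0 3 (by decide) _ _ _ _
      (by simp [Derivation.leibniz, Derivation.leibniz_pow])
      (by simp [Derivation.leibniz, Derivation.leibniz_pow]),
    neg_pow (_ * _ : Module.End ℂ (MvPolynomial (Fin 4) ℂ)), ← MvPolynomial.smul_eq_C_mul,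
    map_smul, Module.End.mul_apply,
    mul_comm (X 0 ^ _ * X 3 ^ _),
    pderiv_comp_pderiv_pow_apply 2 1 (by decide) _ _ _ _
      (by simp [Derivation.leibniz, Derivation.leibniz_pow])
      (by simp [Derivation.leibniz, Derivation.leibniz_pow])]
  rw [neg_one_pow_End_apply, smul_eq_C_mul, nsmul_eq_mul]
  simp only [map_mul, map_pow, map_natCast, Nat.cast_mul]
  ring

/-- The substitution of the linear forms `α x₀ + β x₁`, `γ x₀ + δ x₁` for the variables in each of
the two pairs `x` and `y`. -/
noncomputable def pairSubst (α β γ δ : ℂ) :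
    MvPolynomial (Fin 4) ℂ →ₐ[ℂ] MvPolynomial (Fin 4) ℂ :=
  bind₁ ![C α * X 0 + C β * X 1, C γ * X 0 + C δ * X 1,
    C α * X 2 + C β * X 3, C γ * X 2 + C δ * X 3]

theorem pderiv_bind₁ {σ τ R : Type*} [CommRing R] [Fintype σ] (g : σ → MvPolynomial τ R) (i : τ)
    (F : MvPolynomial σ R) :
    pderiv i (bind₁ g F) = ∑ j, bind₁ g (pderiv j F) * pderiv i (g j) := by
  classical
  induction F using MvPolynomial.induction_on with
  | C a => simp
  | add F G hF hG => simp [hF, hG, add_mul, Finset.sum_add_distrib]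
  | mul_X F s hF =>
    simp [Derivation.leibniz, hF, pderiv_X, Pi.single_apply, add_mul, Finset.sum_add_distrib,
      Finset.mul_sum, apply_ite, mul_assoc]

theorem Omega_pairSubst (α β γ δ : ℂ) (F : MvPolynomial (Fin 4) ℂ) :
    Omega (pairSubst α β γ δ F) = (α * δ - β * γ) • pairSubst α β γ δ (Omega F) := by
  have hcomm (i j : Fin 4) : pderiv i (pderiv j F) = pderiv j (pderiv i F) :=
    LinearMap.congr_fun (commute_pderiv i j) F
  simp [Omega, pairSubst, pderiv_bind₁, Fin.sum_univ_four, pderiv_X,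
    smul_eq_C_mul, Derivation.leibniz]
  rw [hcomm 2 0, hcomm 2 1, hcomm 3 0, hcomm 3 1]
  ring

theorem Omega_pow_pairSubst (α β γ δ : ℂ) (n : ℕ) (F : MvPolynomial (Fin 4) ℂ) :
    (Omega ^ n) (pairSubst α β γ δ F) =
      (α * δ - β * γ) ^ n • pairSubst α β γ δ ((Omega ^ n) F) := by
  induction n with
  | zero => simp
  | succ n ih =>
    rw [pow_succ' Omega, Module.End.mul_apply, ih, map_smul, Omega_pairSubst, smul_smul,
      ← pow_succ, Module.End.mul_apply]

theorem exists_linear_factors (a b c : ℂ) (hdisc : b ^ 2 - 4 * a * c ≠ 0) :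
    ∃ α β γ δ : ℂ, α * δ - β * γ ≠ 0 ∧ a = α * γ ∧ b = α * δ + β * γ ∧ c = β * δ := by
  by_cases ha : a = 0
  · subst ha
    refine ⟨0, 1, b, c, ?_, by simp, by simp, by simp⟩
    intro h
    apply hdisc
    have : b = 0 := by linear_combination -h
    simp [this]
  · obtain ⟨d, hd⟩ := IsAlgClosed.exists_pow_nat_eq (b ^ 2 - 4 * a * c) two_pos
    have hd0 : d ≠ 0 := by rintro rfl; exact hdisc (by simp [← hd])
    refine ⟨a, (b - d) / 2, 1, (b + d) / (2 * a), ?_, by simp, ?_, ?_⟩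
    · have : a * ((b + d) / (2 * a)) - (b - d) / 2 * 1 = d := by field_simp; ring
      rwa [this]
    · field_simp; ring
    · field_simp; linear_combination hd

theorem stmt_4 (e p : ℕ) (he : 1 ≤ e) (hp : p ≤ e) (a b c : ℂ)
    (Q : MvPolynomial (Fin 2) ℂ)
    (hQ : Q = C a * X 0 ^ 2 + C b * X 0 * X 1 + C c * X 1 ^ 2)
    (hdisc : b ^ 2 - 4 * a * c ≠ 0) :
    ∃ k : ℂ, k ≠ 0 ∧
      MvPolynomial.aeval (![X 0, X 1, X 0, X 1] : Fin 4 → MvPolynomial (Fin 2) ℂ)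
        ((Omega ^ (2 * p))
          (MvPolynomial.aeval (![X 0, X 1] : Fin 2 → MvPolynomial (Fin 4) ℂ) (Q ^ e) *
            MvPolynomial.aeval (![X 2, X 3] : Fin 2 → MvPolynomial (Fin 4) ℂ) (Q ^ e)))
        = C k * Q ^ (2 * e - 2 * p) ∧
      MvPolynomial.aeval (![X 0, X 1, X 0, X 1] : Fin 4 → MvPolynomial (Fin 2) ℂ)
        ((Omega ^ (2 * p))
          (MvPolynomial.aeval (![X 0, X 1] : Fin 2 → MvPolynomial (Fin 4) ℂ) (Q ^ e) *
            MvPolynomial.aeval (![X 2, X 3] : Fin 2 → MvPolynomial (Fin 4) ℂ) (Q ^ e))) ≠ 0 := by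
  have hQ0 : Q ≠ 0 := by
    rintro rfl
    have h (x y : ℂ) : 0 = a * x ^ 2 + b * x * y + c * y ^ 2 := by
      simpa using congrArg (eval ![x, y]) hQ
    have ha : a = 0 := by linear_combination -h 1 0
    have hb : b = 0 := by linear_combination h 1 0 + h 0 1 - h 1 1
    exact hdisc (by simp [ha, hb])
  obtain ⟨α, β, γ, δ, hdet, rfl, rfl, rfl⟩ := exists_linear_factors a b c hdisc
  have hfac : Q = (C α * X 0 + C β * X 1) * (C γ * X 0 + C δ * X 1) := by
    rw [hQ]
    simp only [map_add, map_mul]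
    ring
  have hsubst : aeval (![X 0, X 1] : Fin 2 → MvPolynomial (Fin 4) ℂ) (Q ^ e) *
      aeval (![X 2, X 3] : Fin 2 → MvPolynomial (Fin 4) ℂ) (Q ^ e) =
      pairSubst α β γ δ (X 0 ^ e * X 1 ^ e * (X 2 ^ e * X 3 ^ e)) := by
    simp [hfac, pairSubst, mul_pow, algebraMap_eq]
  let K : ℤ := ∑ j ∈ Finset.range (2 * p + 1), (-1) ^ j * ((2 * p).choose j : ℤ) *
      (e.descFactorial j * e.descFactorial (2 * p - j) : ℤ) ^ 2
  have hk : (α * δ - β * γ) ^ (2 * p) * (K : ℂ) ≠ 0 :=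
    mul_ne_zero (pow_ne_zero _ hdet)
      (Int.cast_ne_zero.mpr (alternating_sum_descFactorial_ne_zero e p hp))
  have hmain : aeval (![X 0, X 1, X 0, X 1] : Fin 4 → MvPolynomial (Fin 2) ℂ)
      ((Omega ^ (2 * p))
        (aeval (![X 0, X 1] : Fin 2 → MvPolynomial (Fin 4) ℂ) (Q ^ e) *
          aeval (![X 2, X 3] : Fin 2 → MvPolynomial (Fin 4) ℂ) (Q ^ e))) =
      C ((α * δ - β * γ) ^ (2 * p) * (K : ℂ)) * Q ^ (2 * e - 2 * p) := by
    rw [hsubst, Omega_pow_pairSubst, Omega_pow_apply, map_smul, map_sum, map_sum, map_mul C,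
      mul_assoc, ← smul_eq_C_mul]
    congr 1
    simp only [K, Int.cast_sum, map_sum, Finset.sum_mul]
    refine Finset.sum_congr rfl fun j hj => ?_
    have hj' : j ≤ 2 * p := Finset.mem_range_succ_iff.mp hj
    by_cases h₁ : j ≤ e
    · by_cases h₂ : 2 * p - j ≤ e
      · rw [show 2 * e - 2 * p = (e - (2 * p - j)) + (e - j) by omega, hfac]
        simp [pairSubst, algebraMap_eq, mul_pow, pow_add]
      · simp [Nat.descFactorial_of_lt (not_le.mp h₂)]
    · simp [Nat.descFactorial_of_lt (not_le.mp h₁)]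
  refine ⟨_, hk, hmain, ?_⟩
  rw [hmain]
  exact mul_ne_zero (C_ne_zero.mpr hk) (pow_ne_zero _ hQ0)
end

section
/- (Dixon's theorem, terminating case) For nonnegative integers $p, e$ with $2p \le e$, $\sum_{i=0}^{2p} \frac{(-2p)_i\,(-e)_i\,(-e)_i}{i!\,(e-2p+1)_i\,(e-2p+1)_i} = (-1)^p\,\frac{(2p)!\,(2e-p)!\,((e-2p)!)^2}{p!\,(2e-2p)!\,((e-p)!)^2}$, where $(a)_i$ denotes the rising factorial. -/
open Finset

/-- The reciprocal factorial on the integers, extended by zero to negative arguments. -/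
def invFactorial (z : ℤ) : ℚ := if z < 0 then 0 else ((z.toNat.factorial : ℚ))⁻¹

theorem invFactorial_natCast (n : ℕ) : invFactorial n = ((n.factorial : ℚ))⁻¹ := by
  simp [invFactorial]

theorem invFactorial_of_neg {z : ℤ} (hz : z < 0) : invFactorial z = 0 := by
  simp [invFactorial, hz]

theorem invFactorial_sub_one (z : ℤ) : invFactorial (z - 1) = z * invFactorial z := by
  rcases lt_trichotomy z 0 with hz | rfl | hz
  · rw [invFactorial_of_neg hz, invFactorial_of_neg (by lia), mul_zero]
  · simp [invFactorial]
  · obtain ⟨n, rfl⟩ : ∃ n : ℕ, z = n + 1 := ⟨(z - 1).toNat, by lia⟩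
    rw [add_sub_cancel_right, invFactorial_natCast, ← Nat.cast_succ, invFactorial_natCast,
      Nat.factorial_succ]
    push_cast
    have := Nat.cast_add_one_ne_zero (R := ℚ) n
    field_simp

/-- The summand of the symmetric form of Dixon's sum, without its sign. -/
def dixonTerm (a n k : ℤ) : ℚ :=
  invFactorial (n + k) * invFactorial (n - k) *
    (invFactorial (a + k) * invFactorial (a - k)) ^ 2

theorem dixonTerm_eq_zero {a n k : ℤ} (h : n < |k|) : dixonTerm a n k = 0 := by
  rcases lt_abs.mp h with h | h
  · simp [dixonTerm, invFactorial_of_neg (show n - k < 0 by lia)]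
  · simp [dixonTerm, invFactorial_of_neg (show n + k < 0 by lia)]

theorem dixonTerm_sub_one (a n k : ℤ) :
    dixonTerm a (n - 1) k = (n + k) * (n - k) * dixonTerm a n k := by
  have h₁ := invFactorial_sub_one (n + k)
  have h₂ := invFactorial_sub_one (n - k)
  rw [show n + k - 1 = n - 1 + k by ring] at h₁
  rw [show n - k - 1 = n - 1 - k by ring] at h₂
  rw [dixonTerm, dixonTerm, h₁, h₂]
  push_cast
  ring

theorem dixonTerm_add_one (a n k : ℤ) :
    (n + k + 1) * (a + k + 1) ^ 2 * dixonTerm a n (k + 1) =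
      (n - k) * (a - k) ^ 2 * dixonTerm a n k := by
  have h₁ := invFactorial_sub_one (n + (k + 1))
  have h₂ := invFactorial_sub_one (n - k)
  have h₃ := invFactorial_sub_one (a + (k + 1))
  have h₄ := invFactorial_sub_one (a - k)
  rw [show n + (k + 1) - 1 = n + k by ring] at h₁
  rw [show n - k - 1 = n - (k + 1) by ring] at h₂
  rw [show a + (k + 1) - 1 = a + k by ring] at h₃
  rw [show a - k - 1 = a - (k + 1) by ring] at h₄
  rw [dixonTerm, dixonTerm, h₁, h₂, h₃, h₄]
  push_cast
  ring

theorem sum_range_dixonTerm_telescope (a n : ℤ) (m : ℕ) :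
    ∑ i ∈ range m, (-1 : ℚ) ^ i * ((n + 2 * a) * dixonTerm a (n - 1) (i - n) -
      n * (n + a) ^ 2 * dixonTerm a n (i - n)) =
      (-1) ^ m * (m * (a + m - n) ^ 2 * dixonTerm a n (m - n)) / 2 := by
  induction m with
  | zero => simp
  | succ m ih =>
    have h := dixonTerm_add_one a n (m - n)
    rw [show (m : ℤ) - n + 1 = (m + 1 : ℕ) - n by push_cast; ring] at h
    rw [sum_range_succ, ih, dixonTerm_sub_one, pow_succ]
    push_cast at h ⊢
    linear_combination (1 / 2) * (-1) ^ m * h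

theorem sum_dixonTerm_succ (a n : ℕ) :
    ((n : ℚ) + 1 + 2 * a) *
        ∑ i ∈ range (2 * n + 1), (-1 : ℚ) ^ i * dixonTerm a n (i - n) =
      -((n + 1) * (n + 1 + a) ^ 2 *
        ∑ i ∈ range (2 * (n + 1) + 1), (-1 : ℚ) ^ i * dixonTerm a (n + 1) (i - (n + 1))) := by
  have h := sum_range_dixonTerm_telescope a (n + 1) (2 * (n + 1) + 1)
  rw [dixonTerm_eq_zero (k := ((2 * (n + 1) + 1 : ℕ) : ℤ) - (n + 1))
    (by rw [lt_abs]; left; push_cast; lia)] at h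
  have hs : ∑ i ∈ range (2 * (n + 1) + 1), (-1 : ℚ) ^ i * dixonTerm a n (i - (n + 1)) =
      -∑ i ∈ range (2 * n + 1), (-1 : ℚ) ^ i * dixonTerm a n (i - n) := by
    rw [show 2 * (n + 1) + 1 = 2 * n + 1 + 1 + 1 by ring, sum_range_succ, sum_range_succ',
      dixonTerm_eq_zero (k := ((2 * n + 1 + 1 : ℕ) : ℤ) - (n + 1))
        (by rw [lt_abs]; left; push_cast; lia),
      dixonTerm_eq_zero (k := ((0 : ℕ) : ℤ) - (n + 1)) (by rw [lt_abs]; right; push_cast; lia),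
      mul_zero, mul_zero, add_zero, add_zero, ← sum_neg_distrib]
    refine sum_congr rfl fun i _ => ?_
    rw [show ((i + 1 : ℕ) : ℤ) - (n + 1) = i - n by push_cast; ring, pow_succ]
    ring
  simp only [mul_sub, sum_sub_distrib, mul_left_comm ((-1 : ℚ) ^ _), ← mul_sum,
    add_sub_cancel_right, hs] at h
  push_cast at h ⊢
  linear_combination -h

/-- Dixon's identity in symmetric form. -/
theorem sum_dixonTerm (a n : ℕ) :
    ∑ i ∈ range (2 * n + 1), (-1 : ℚ) ^ i * dixonTerm a n (i - n) =
      (-1) ^ n * ((n + 2 * a).factorial : ℚ) /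
        (n.factorial * (2 * a).factorial * ((n + a).factorial * a.factorial : ℚ) ^ 2) := by
  induction n with
  | zero =>
    have h0 : invFactorial 0 = 1 := by simp [invFactorial]
    have := Nat.cast_ne_zero (R := ℚ).mpr (2 * a).factorial_ne_zero
    have := Nat.cast_ne_zero (R := ℚ).mpr a.factorial_ne_zero
    simp [dixonTerm, h0, invFactorial_natCast]
    field_simp
  | succ n ih =>
    have h := sum_dixonTerm_succ a n
    rw [ih] at h
    have hn : (n : ℚ) + 1 ≠ 0 := by positivity
    have hna : (n : ℚ) + 1 + a ≠ 0 := by positivity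
    push_cast
    refine mul_left_cancel₀ (mul_ne_zero hn (pow_ne_zero 2 hna)) ?_
    rw [neg_eq_iff_eq_neg.mp h.symm, show n + 1 + 2 * a = n + 2 * a + 1 by ring,
      show n + 1 + a = n + a + 1 by ring, Nat.factorial_succ, Nat.factorial_succ,
      Nat.factorial_succ]
    have := Nat.cast_ne_zero (R := ℚ).mpr (2 * a).factorial_ne_zero
    have := Nat.cast_ne_zero (R := ℚ).mpr a.factorial_ne_zero
    have := Nat.cast_ne_zero (R := ℚ).mpr n.factorial_ne_zero
    have := Nat.cast_ne_zero (R := ℚ).mpr (n + a).factorial_ne_zero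
    have : (n : ℚ) + a + 1 ≠ 0 := by positivity
    push_cast
    field_simp
    ring

theorem ascPochhammer_eval_neg_natCast (m i : ℕ) :
    (ascPochhammer ℚ i).eval (-(m : ℚ)) = (-1) ^ i * m.factorial * invFactorial (m - i) := by
  induction i with
  | zero =>
    have := Nat.cast_ne_zero (R := ℚ).mpr m.factorial_ne_zero
    simp [invFactorial_natCast, this]
  | succ i ih =>
    rw [ascPochhammer_succ_eval, ih,
      show (m : ℤ) - (i + 1 : ℕ) = m - i - 1 by push_cast; ring, invFactorial_sub_one]
    push_cast
    ring

theorem inv_ascPochhammer_eval_natCast_add_one (d i : ℕ) :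
    ((ascPochhammer ℚ i).eval ((d : ℚ) + 1))⁻¹ = d.factorial * invFactorial (d + i) := by
  have h : (d.factorial : ℚ) * (ascPochhammer ℚ i).eval ((d : ℚ) + 1) = (d + i).factorial := by
    rw [← Nat.factorial_mul_ascFactorial d i, ← ascPochhammer_nat_eq_ascFactorial]
    push_cast
    rfl
  have := Nat.cast_ne_zero (R := ℚ).mpr d.factorial_ne_zero
  rw [← Nat.cast_add, invFactorial_natCast, ← h, mul_inv, mul_inv_cancel_left₀ this]

theorem stmt_10 (p e : ℕ) (hpe : 2 * p ≤ e) :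
    ∑ i ∈ Finset.range (2 * p + 1),
      ((ascPochhammer ℚ i).eval (-(2 * p : ℚ)) * (ascPochhammer ℚ i).eval (-(e : ℚ)) *
          (ascPochhammer ℚ i).eval (-(e : ℚ)) /
        ((Nat.factorial i : ℚ) * (ascPochhammer ℚ i).eval ((e : ℚ) - 2 * p + 1) *
          (ascPochhammer ℚ i).eval ((e : ℚ) - 2 * p + 1)))
    = (-1 : ℚ) ^ p * ((Nat.factorial (2 * p) : ℚ) * (Nat.factorial (2 * e - p) : ℚ) *
        (Nat.factorial (e - 2 * p) : ℚ) ^ 2) /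
      ((Nat.factorial p : ℚ) * (Nat.factorial (2 * e - 2 * p) : ℚ) *
        (Nat.factorial (e - p) : ℚ) ^ 2) := by
  obtain ⟨d, rfl⟩ := Nat.exists_eq_add_of_le hpe
  have hterm : ∀ i ∈ range (2 * p + 1),
      ((ascPochhammer ℚ i).eval (-(2 * p : ℚ)) *
          (ascPochhammer ℚ i).eval (-((2 * p + d : ℕ) : ℚ)) *
          (ascPochhammer ℚ i).eval (-((2 * p + d : ℕ) : ℚ)) /
        ((Nat.factorial i : ℚ) *
          (ascPochhammer ℚ i).eval (((2 * p + d : ℕ) : ℚ) - 2 * p + 1) *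
          (ascPochhammer ℚ i).eval (((2 * p + d : ℕ) : ℚ) - 2 * p + 1))) =
      (2 * p).factorial * ((2 * p + d).factorial * d.factorial : ℚ) ^ 2 *
        ((-1) ^ i * dixonTerm (p + d : ℕ) p (i - p)) := by
    intro i _
    rw [show (2 * p : ℚ) = (2 * p : ℕ) by push_cast; ring,
      show ((2 * p + d : ℕ) : ℚ) - (2 * p : ℕ) + 1 = d + 1 by push_cast; ring,
      div_eq_mul_inv, mul_inv, mul_inv, inv_ascPochhammer_eval_natCast_add_one,
      ascPochhammer_eval_neg_natCast, ascPochhammer_eval_neg_natCast, ← invFactorial_natCast,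
      dixonTerm, show (p : ℤ) + (i - p) = i by ring,
      show (p : ℤ) - (i - p) = (2 * p : ℕ) - i by push_cast; ring,
      show ((p + d : ℕ) : ℤ) + (i - p) = d + i by push_cast; ring,
      show ((p + d : ℕ) : ℤ) - (i - p) = (2 * p + d : ℕ) - i by push_cast; ring]
    have hsq : ((-1 : ℚ) ^ i) ^ 2 = 1 := by rw [← pow_mul, mul_comm, pow_mul]; simp
    linear_combination (-1 : ℚ) ^ i * ((2 * p).factorial *
      ((2 * p + d).factorial * d.factorial : ℚ) ^ 2 * (invFactorial i *
        invFactorial ((2 * p : ℕ) - i) *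
        (invFactorial (d + i) * invFactorial ((2 * p + d : ℕ) - i)) ^ 2)) * hsq
  rw [sum_congr rfl hterm, ← mul_sum, sum_dixonTerm,
    show 2 * (2 * p + d) - p = p + 2 * (p + d) by lia,
    show 2 * (2 * p + d) - 2 * p = 2 * (p + d) by lia,
    show 2 * p + d - 2 * p = d by lia, show 2 * p + d - p = p + d by lia,
    show p + (p + d) = 2 * p + d by ring]
  have := Nat.cast_ne_zero (R := ℚ).mpr (2 * p + d).factorial_ne_zero
  field_simp
end
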